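/- arXiv:math/0603670 — 2 statements merged into one kernel-verified Lean document; each statement's English description precedes it below -/
import Mathlib

section
/- Let (W,S) be an irreducible, infinite, non-affine Coxeter system of finite rank and let R be a commutative ring with identity. Then the center of the group ring R[W] is R (i.e., consists exactly of the scalar multiples of the identity element of W). -/
namespace CoxeterPaper

/-- The entry `-cos (π / m i j)` of the matrix of the standard bilinear form,
interpreted as `-1` when `m i j = ∞` (encoded as `0`). -/
noncomputable def formEntry {B : Type*} (M : CoxeterMatrix B) (i j : B) : ℝ :=
  if M i j = 0 then -1 else - Real.cos (Real.pi / (M i j : ℝ))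

/-- The standard bilinear form associated to a Coxeter matrix, on `V = B → ℝ`
(with basis `{α_s : s ∈ S}` identified with the standard basis). -/
noncomputable def bilin {B : Type*} [Fintype B] (M : CoxeterMatrix B) (v w : B → ℝ) : ℝ :=
  ∑ i, ∑ j, v i * w j * formEntry M i j

/-- The standard bilinear form is positive definite. -/
def IsPosDef {B : Type*} [Fintype B] (M : CoxeterMatrix B) : Prop :=
  ∀ v : B → ℝ, v ≠ 0 → 0 < bilin M v v

/-- The standard bilinear form is positive semidefinite. -/
def IsPosSemidef {B : Type*} [Fintype B] (M : CoxeterMatrix B) : Prop :=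
  ∀ v : B → ℝ, 0 ≤ bilin M v v

/-- The Coxeter graph: vertices are the elements of `B`, and `i ≠ j` are adjacent
iff `m i j ≥ 3` (including `m i j = ∞`, encoded as `0`), i.e. iff `m i j ≠ 2`. -/
def coxeterGraph {B : Type*} (M : CoxeterMatrix B) : SimpleGraph B :=
  SimpleGraph.fromRel fun i j => M i j ≠ 2

/-- A Coxeter matrix (system) is irreducible if its Coxeter graph is connected. -/
def IsIrreducible {B : Type*} (M : CoxeterMatrix B) : Prop := (coxeterGraph M).Connected

section CoxeterMatrixEntries

variable {B : Type*} (M : CoxeterMatrix B)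

lemma formEntry_symm (i j : B) : formEntry M i j = formEntry M j i := by
  simp only [formEntry, M.symmetric i j]

lemma formEntry_self (i : B) : formEntry M i i = 1 := by
  simp [formEntry]

lemma neg_one_le_formEntry (i j : B) : -1 ≤ formEntry M i j := by
  unfold formEntry
  split_ifs
  · exact le_rfl
  · linarith [Real.cos_le_one (Real.pi / (M i j : ℝ))]

lemma two_le_of_ne_zero {i j : B} (hij : i ≠ j) (h : M i j ≠ 0) : 2 ≤ M i j := by
  have := M.off_diagonal i j hij
  omega

lemma pi_div_le {i j : B} (hij : i ≠ j) (h : M i j ≠ 0) :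
    Real.pi / (M i j : ℝ) ≤ Real.pi / 2 := by
  have h2 : (2 : ℝ) ≤ M i j := by exact_mod_cast two_le_of_ne_zero M hij h
  exact div_le_div_of_nonneg_left Real.pi_pos.le two_pos h2

lemma pi_div_pos {i j : B} (h : M i j ≠ 0) : 0 < Real.pi / (M i j : ℝ) := by
  have : (0 : ℝ) < M i j := by exact_mod_cast Nat.pos_of_ne_zero h
  exact div_pos Real.pi_pos this

lemma formEntry_nonpos {i j : B} (hij : i ≠ j) : formEntry M i j ≤ 0 := by
  unfold formEntry
  split_ifs with h
  · norm_num
  · have := Real.cos_nonneg_of_neg_pi_div_two_le_of_le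
      (by linarith [pi_div_pos M h, Real.pi_pos]) (pi_div_le M hij h)
    linarith

lemma formEntry_ne_zero {i j : B} (hij : i ≠ j) (h2 : M i j ≠ 2) : formEntry M i j ≠ 0 := by
  unfold formEntry
  split_ifs with h
  · norm_num
  · have h3 : (2 : ℝ) < M i j := by
      have := two_le_of_ne_zero M hij h
      exact_mod_cast lt_of_le_of_ne this (Ne.symm h2)
    have := Real.cos_pos_of_mem_Ioo (x := Real.pi / (M i j : ℝ))
      ⟨by linarith [pi_div_pos M h, Real.pi_pos],
        div_lt_div_of_pos_left Real.pi_pos two_pos h3⟩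
    linarith

variable {M} in
lemma forall_of_adj (hirr : IsIrreducible M) {p : B → Prop} {i : B} (hi : p i)
    (hstep : ∀ j k, formEntry M j k ≠ 0 → p j → p k) (j : B) : p j := by
  obtain ⟨walk⟩ := hirr.preconnected i j
  induction walk with
  | nil => exact hi
  | cons hadj _ ih =>
    refine ih (hstep _ _ ?_ hi)
    rw [coxeterGraph, SimpleGraph.fromRel_adj] at hadj
    rw [M.symmetric, or_self] at hadj
    rw [formEntry_symm]
    exact formEntry_ne_zero M hadj.1.symm hadj.2

end CoxeterMatrixEntries

section SinQuot

/-- The sequence `sin (n θ) / sin θ`, in terms of `c = cos θ`. -/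
noncomputable def sinQuot (c : ℝ) : ℕ → ℝ
  | 0 => 0
  | 1 => 1
  | n + 2 => 2 * c * sinQuot c (n + 1) - sinQuot c n

lemma sin_mul_sinQuot (θ : ℝ) : ∀ n : ℕ, Real.sin θ * sinQuot (Real.cos θ) n = Real.sin (n * θ)
  | 0 => by simp [sinQuot]
  | 1 => by simp [sinQuot]
  | n + 2 => by
    have h1 := sin_mul_sinQuot θ (n + 1)
    have h0 := sin_mul_sinQuot θ n
    have e1 : ((n + 2 : ℕ) : ℝ) * θ = ((n + 1 : ℕ) : ℝ) * θ + θ := by push_cast; ring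
    have e0 : (n : ℝ) * θ = ((n + 1 : ℕ) : ℝ) * θ - θ := by push_cast; ring
    rw [sinQuot, e1, Real.sin_add]
    rw [e0, Real.sin_sub] at h0
    linear_combination 2 * Real.cos θ * h1 - h0

lemma sinQuot_one : ∀ n : ℕ, sinQuot 1 n = n
  | 0 => by simp [sinQuot]
  | 1 => by simp [sinQuot]
  | n + 2 => by
    rw [sinQuot, sinQuot_one (n + 1), sinQuot_one n]
    push_cast
    ring

lemma sinQuot_nonneg {B : Type*} {M : CoxeterMatrix B} {i j : B} (hij : i ≠ j) {k : ℕ}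
    (hk : M i j = 0 ∨ k ≤ M i j) :
    0 ≤ sinQuot (-formEntry M i j) k := by
  unfold formEntry
  split_ifs with h
  · rw [neg_neg, sinQuot_one]
    positivity
  · have hk := hk.resolve_left h
    have h2 := two_le_of_ne_zero M hij h
    have hm0 : (0 : ℝ) < M i j := by exact_mod_cast (by omega : 0 < M i j)
    have hm1 : (1 : ℝ) < M i j := by exact_mod_cast (by omega : 1 < M i j)
    have hsin : 0 < Real.sin (Real.pi / M i j) :=
      Real.sin_pos_of_pos_of_lt_pi (div_pos Real.pi_pos hm0) (div_lt_self Real.pi_pos hm1)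
    have hle : (k : ℝ) * (Real.pi / M i j) ≤ Real.pi := by
      have : (k : ℝ) ≤ M i j := by exact_mod_cast hk
      calc (k : ℝ) * (Real.pi / M i j) ≤ M i j * (Real.pi / M i j) := by gcongr
        _ = Real.pi := by field_simp
    have hs := Real.sin_nonneg_of_nonneg_of_le_pi (by positivity) hle
    rw [← sin_mul_sinQuot] at hs
    rw [neg_neg]
    exact nonneg_of_mul_nonneg_right hs hsin

end SinQuot

section Geometric

variable {B : Type*} [Fintype B] (M : CoxeterMatrix B)

/-- The standard bilinear form as a bundled bilinear form. -/
noncomputable def form : LinearMap.BilinForm ℝ (B → ℝ) :=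
  LinearMap.mk₂ ℝ (bilin M)
    (fun u v w => by simp only [bilin, Pi.add_apply, add_mul, Finset.sum_add_distrib])
    (fun c u v => by
      simp only [bilin, Pi.smul_apply, smul_eq_mul, Finset.mul_sum, mul_assoc])
    (fun u v w => by
      simp only [bilin, Pi.add_apply, mul_add, add_mul, Finset.sum_add_distrib])
    (fun c u v => by
      simp only [bilin, Pi.smul_apply, smul_eq_mul, Finset.mul_sum]
      refine Finset.sum_congr rfl fun i _ => Finset.sum_congr rfl fun j _ => by ring)

lemma form_apply (v w : B → ℝ) : form M v w = ∑ i, ∑ j, v i * w j * formEntry M i j := rfl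

lemma form_symm (v w : B → ℝ) : form M v w = form M w v := by
  rw [form_apply, form_apply, Finset.sum_comm]
  refine Finset.sum_congr rfl fun i _ => Finset.sum_congr rfl fun j _ => ?_
  rw [formEntry_symm M i j]
  ring

/-- The reflection in a vector `a`, with respect to the standard bilinear form. -/
noncomputable def refl (a : B → ℝ) : Module.End ℝ (B → ℝ) :=
  LinearMap.id - (2 : ℝ) • (form M a).smulRight a

lemma refl_apply (a v : B → ℝ) : refl M a v = v - (2 * form M a v) • a := by
  simp [refl, mul_smul]

lemma refl_self {a : B → ℝ} (ha : form M a a = 1) : refl M a a = -a := by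
  rw [refl_apply, ha]
  module

lemma form_refl_refl {a : B → ℝ} (ha : form M a a = 1) (u v : B → ℝ) :
    form M (refl M a u) (refl M a v) = form M u v := by
  simp only [refl_apply, map_sub, map_smul, LinearMap.sub_apply, LinearMap.smul_apply,
    smul_eq_mul, ha, form_symm M u a]
  ring

lemma refl_mul_refl {a : B → ℝ} (ha : form M a a = 1) : refl M a * refl M a = 1 := by
  ext1 v
  simp only [Module.End.mul_apply, Module.End.one_apply, refl_apply, map_sub, map_smul, ha]
  module

lemma refl_sinQuot {a b : B → ℝ} {c : ℝ} (hb : form M b b = 1) (hab : form M b a = -c) (k : ℕ) :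
    refl M b (sinQuot c (k + 1) • a + sinQuot c k • b) =
      sinQuot c (k + 1) • a + sinQuot c (k + 2) • b := by
  rw [refl_apply, sinQuot]
  simp only [map_add, map_smul, hb, hab, smul_eq_mul]
  module

lemma refl_mul_refl_pow_apply {a b : B → ℝ} {c : ℝ} (ha : form M a a = 1) (hb : form M b b = 1)
    (hab : form M a b = -c) (k : ℕ) :
    ((refl M a * refl M b) ^ k) a = sinQuot c (2 * k + 1) • a + sinQuot c (2 * k) • b := by
  induction k with
  | zero => simp [sinQuot]
  | succ k ih =>
    rw [pow_succ', Module.End.mul_apply, ih, Module.End.mul_apply,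
      refl_sinQuot M hb ((form_symm M b a).trans hab), add_comm, refl_sinQuot M ha hab, add_comm,
      show 2 * (k + 1) + 1 = 2 * k + 1 + 2 by ring, show 2 * (k + 1) = 2 * k + 2 by ring]

lemma refl_mul_refl_pow_eq_one {a b : B → ℝ} {m : ℕ} (hm : 2 ≤ m) (ha : form M a a = 1)
    (hb : form M b b = 1) (hab : form M a b = -Real.cos (Real.pi / m)) :
    (refl M a * refl M b) ^ m = 1 := by
  have hm0 : (0 : ℝ) < m := by exact_mod_cast (by omega : 0 < m)
  have hm1 : (1 : ℝ) < m := by exact_mod_cast (by omega : 1 < m)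
  have hsin : 0 < Real.sin (Real.pi / m) :=
    Real.sin_pos_of_pos_of_lt_pi (div_pos Real.pi_pos hm0) (div_lt_self Real.pi_pos hm1)
  set c := Real.cos (Real.pi / m) with hc
  have q0 : sinQuot c (2 * m) = 0 := by
    have := sin_mul_sinQuot (Real.pi / m) (2 * m)
    rw [show ((2 * m : ℕ) : ℝ) * (Real.pi / m) = 2 * Real.pi by push_cast; field_simp,
      Real.sin_two_pi] at this
    exact (mul_eq_zero.mp this).resolve_left hsin.ne'
  have q1 : sinQuot c (2 * m + 1) = 1 := by
    have := sin_mul_sinQuot (Real.pi / m) (2 * m + 1)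
    rw [show ((2 * m + 1 : ℕ) : ℝ) * (Real.pi / m) = Real.pi / m + 2 * Real.pi by
      push_cast; field_simp; ring, Real.sin_add_two_pi] at this
    exact mul_left_cancel₀ hsin.ne' (this.trans (mul_one _).symm)
  have fixa : ((refl M a * refl M b) ^ m) a = a := by
    rw [refl_mul_refl_pow_apply M ha hb hab, q0, q1]
    simp
  have fixb' : ((refl M b * refl M a) ^ m) b = b := by
    rw [refl_mul_refl_pow_apply M hb ha ((form_symm M b a).trans hab), q0, q1]
    simp
  have hinv : (refl M a * refl M b) ^ m * (refl M b * refl M a) ^ m = 1 := by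
    have key : (refl M a * refl M b) * (refl M b * refl M a) = 1 := by
      rw [mul_assoc, ← mul_assoc (refl M b), refl_mul_refl M hb, one_mul, refl_mul_refl M ha]
    have key' : (refl M b * refl M a) * (refl M a * refl M b) = 1 := by
      rw [mul_assoc, ← mul_assoc (refl M a), refl_mul_refl M ha, one_mul, refl_mul_refl M hb]
    have hcomm : Commute (refl M a * refl M b) (refl M b * refl M a) := by
      rw [Commute, SemiconjBy, key, key']
    rw [← hcomm.mul_pow, key, one_pow]
  have fixb : ((refl M a * refl M b) ^ m) b = b := by
    have h := LinearMap.congr_fun hinv b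
    rwa [Module.End.mul_apply, fixb', Module.End.one_apply] at h
  have hd : 1 - c ^ 2 ≠ 0 := by
    have := Real.sin_sq_add_cos_sq (Real.pi / m)
    rw [← hc] at this
    have : 0 < Real.sin (Real.pi / m) ^ 2 := by positivity
    linarith
  ext1 v
  set x := (form M a v + c * form M b v) / (1 - c ^ 2) with hx
  set y := (form M b v + c * form M a v) / (1 - c ^ 2) with hy
  set z := v - x • a - y • b with hz
  have hza : form M a z = 0 := by
    simp only [hz, map_sub, map_smul, ha, hab, smul_eq_mul, hx, hy]
    field_simp
    ring
  have hzb : form M b z = 0 := by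
    simp only [hz, map_sub, map_smul, hb, form_symm M b a, hab, smul_eq_mul, hx, hy]
    field_simp
    ring
  have fixz : ∀ k : ℕ, ((refl M a * refl M b) ^ k) z = z := by
    intro k
    induction k with
    | zero => rfl
    | succ k ih =>
      rw [pow_succ', Module.End.mul_apply, ih, Module.End.mul_apply, refl_apply M b, hzb,
        mul_zero, zero_smul, sub_zero, refl_apply, hza, mul_zero, zero_smul, sub_zero]
  have hv : v = z + x • a + y • b := by rw [hz]; module
  rw [hv]
  simp only [map_add, map_smul, fixa, fixb, fixz, Module.End.one_apply]

lemma refl_refl_sub_smul {a b : B → ℝ} {x y : ℝ} (ha : form M a a = 1) (hb : form M b b = 1)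
    (hadd : x + y = 2 * form M a b) (hmul : x * y = 1) :
    refl M a (refl M b (a - x • b)) = (y ^ 2) • (a - x • b) := by
  have hab : form M a b = (x + y) / 2 := by linarith
  have h1 : refl M b (a - x • b) = a - y • b := by
    rw [refl_apply]
    simp only [map_sub, map_smul, hb, form_symm M b a, hab, smul_eq_mul]
    module
  rw [h1, refl_apply]
  simp only [map_sub, map_smul, ha, hab, smul_eq_mul]
  have h2 : y ^ 2 * x = y := by linear_combination y * hmul
  rw [smul_sub, smul_smul, h2]
  have h3 : a - y • b - (2 * (1 - y * ((x + y) / 2))) • a = (x * y + y ^ 2 - 1) • a - y • b := by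
    module
  rw [h3, hmul]
  module

end Geometric

section Representation

variable {B W : Type*} [Fintype B] [DecidableEq B] [Group W] {M : CoxeterMatrix B}

lemma form_single (M : CoxeterMatrix B) (i j : B) :
    form M (Pi.single i 1) (Pi.single j 1) = formEntry M i j := by
  simp [form_apply, Pi.single_apply]

lemma form_single_self (M : CoxeterMatrix B) (i : B) :
    form M (Pi.single i 1) (Pi.single i 1) = 1 := by
  rw [form_single, formEntry_self]

lemma eq_sum_single (v : B → ℝ) : v = ∑ i, v i • Pi.single i (1 : ℝ) := by
  ext j
  simp [Finset.sum_apply, Pi.single_apply]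

lemma isLiftable_refl (M : CoxeterMatrix B) : M.IsLiftable fun i => refl M (Pi.single i 1) := by
  intro i j
  rcases eq_or_ne i j with rfl | hij
  · rw [M.diagonal, pow_one, refl_mul_refl M (form_single_self M i)]
  · by_cases h : M i j = 0
    · rw [h, pow_zero]
    · refine refl_mul_refl_pow_eq_one M (two_le_of_ne_zero M hij h) (form_single_self M i)
        (form_single_self M j) ?_
      rw [form_single, formEntry, if_neg h]

/-- The geometric representation of a Coxeter group. -/
noncomputable def geomRep (cs : CoxeterSystem M W) : W →* Module.End ℝ (B → ℝ) :=
  cs.lift ⟨fun i => refl M (Pi.single i 1), isLiftable_refl M⟩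

variable (cs : CoxeterSystem M W)

lemma geomRep_simple (i : B) : geomRep cs (cs.simple i) = refl M (Pi.single i 1) :=
  cs.lift_apply_simple (isLiftable_refl M) i

lemma geomRep_mul_apply (g h : W) (v : B → ℝ) :
    geomRep cs (g * h) v = geomRep cs g (geomRep cs h v) := by
  rw [map_mul, Module.End.mul_apply]

lemma geomRep_inv_apply (g : W) (v : B → ℝ) : geomRep cs g⁻¹ (geomRep cs g v) = v := by
  rw [← geomRep_mul_apply, inv_mul_cancel, map_one, Module.End.one_apply]

lemma geomRep_apply_inv (g : W) (v : B → ℝ) : geomRep cs g (geomRep cs g⁻¹ v) = v := by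
  rw [← geomRep_mul_apply, mul_inv_cancel, map_one, Module.End.one_apply]

lemma form_geomRep (g : W) (u v : B → ℝ) :
    form M (geomRep cs g u) (geomRep cs g v) = form M u v := by
  induction g using cs.simple_induction_left generalizing u v with
  | one => simp
  | mul_simple_left g i ih =>
    rw [geomRep_mul_apply, geomRep_mul_apply, geomRep_simple,
      form_refl_refl M (form_single_self M i), ih]

/-- The roots of a Coxeter system. -/
def roots : Set (B → ℝ) := {v | ∃ (g : W) (i : B), geomRep cs g (Pi.single i 1) = v}

lemma single_mem_roots (i : B) : Pi.single i 1 ∈ roots cs := ⟨1, i, by simp⟩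

lemma geomRep_mem_roots (g : W) {v : B → ℝ} (hv : v ∈ roots cs) : geomRep cs g v ∈ roots cs := by
  obtain ⟨h, i, rfl⟩ := hv
  exact ⟨g * h, i, geomRep_mul_apply cs g h _⟩

lemma form_self_of_mem_roots {v : B → ℝ} (hv : v ∈ roots cs) : form M v v = 1 := by
  obtain ⟨g, i, rfl⟩ := hv
  rw [form_geomRep, form_single_self]

lemma exists_geomRep_eq_refl {v : B → ℝ} (hv : v ∈ roots cs) : ∃ t : W, geomRep cs t = refl M v := by
  obtain ⟨g, i, rfl⟩ := hv
  refine ⟨g * cs.simple i * g⁻¹, LinearMap.ext fun v => ?_⟩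
  have h : form M (geomRep cs g (Pi.single i 1)) v = form M (Pi.single i 1) (geomRep cs g⁻¹ v) := by
    conv_lhs => rw [← geomRep_apply_inv cs g v, form_geomRep]
  rw [geomRep_mul_apply, geomRep_mul_apply, geomRep_simple, refl_apply, refl_apply, map_sub,
    map_smul, geomRep_apply_inv, h]

lemma refl_mem_roots {u v : B → ℝ} (hu : u ∈ roots cs) (hv : v ∈ roots cs) :
    refl M u v ∈ roots cs := by
  obtain ⟨t, ht⟩ := exists_geomRep_eq_refl cs hu
  exact ht ▸ geomRep_mem_roots cs t hv

lemma neg_mem_roots {v : B → ℝ} (hv : v ∈ roots cs) : -v ∈ roots cs :=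
  refl_self M (form_self_of_mem_roots cs hv) ▸ refl_mem_roots cs hv hv

lemma geomRep_alternatingWord {i j : B} {c : ℝ} (hc : formEntry M i j = -c) (k : ℕ) :
    geomRep cs (cs.wordProd (CoxeterSystem.alternatingWord i j k)) (Pi.single i 1) =
      if Even k then sinQuot c (k + 1) • Pi.single i 1 + sinQuot c k • Pi.single j 1
      else sinQuot c k • Pi.single i 1 + sinQuot c (k + 1) • Pi.single j 1 := by
  induction k with
  | zero => simp [CoxeterSystem.alternatingWord, sinQuot]
  | succ k ih =>
    rw [CoxeterSystem.alternatingWord_succ', cs.wordProd_cons, geomRep_mul_apply, ih]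
    by_cases hk : Even k
    · have hk' : ¬ Even (k + 1) := by simpa [Nat.even_add_one] using hk
      rw [if_pos hk, if_pos hk, if_neg hk', geomRep_simple,
        refl_sinQuot M (form_single_self M j)
          (by rw [form_single, formEntry_symm, hc])]
    · have hk' : Even (k + 1) := by simpa [Nat.even_add_one] using hk
      rw [if_neg hk, if_neg hk, if_pos hk', geomRep_simple, add_comm,
        refl_sinQuot M (form_single_self M i) (by rw [form_single, hc]), add_comm]

/-- A simple root which is not a right descent of `w` is sent by `w` to a positive root. -/
lemma geomRep_single_nonneg (w : W) (i : B) (hw : ¬ cs.IsRightDescent w i) :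
    0 ≤ geomRep cs w (Pi.single i 1) := by
  induction hn : cs.length w using Nat.strong_induction_on generalizing w i with
  | _ n ih =>
  subst hn
  rcases eq_or_ne w 1 with rfl | hw1
  · simp
  obtain ⟨j, hj⟩ := cs.exists_rightDescent_of_ne_one hw1
  have hij : i ≠ j := by rintro rfl; exact hw hj
  let alt (k : ℕ) : W := cs.wordProd (CoxeterSystem.alternatingWord i j k)
  have halt (k : ℕ) : cs.length (alt k) ≤ k := by
    simpa using cs.length_wordProd_le (CoxeterSystem.alternatingWord i j k)
  have halt_succ (k : ℕ) : alt (k + 1) = cs.simple (if Even k then j else i) * alt k := by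
    simp only [alt]
    rw [CoxeterSystem.alternatingWord_succ', cs.wordProd_cons]
  let P (k : ℕ) : Prop := ∃ v, v * alt k = w ∧ cs.length v + k = cs.length w
  classical
  have hP1 : P 1 := by
    refine ⟨w * cs.simple j, ?_, ?_⟩
    · simp [alt, CoxeterSystem.alternatingWord]
    · exact cs.isRightDescent_iff.mp hj
  have hP1le : 1 ≤ cs.length w := by
    obtain ⟨v, -, hv⟩ := hP1
    omega
  set k := Nat.findGreatest P (cs.length w) with hk
  have hPk : P k := Nat.findGreatest_spec hP1le hP1
  have hk1 : 1 ≤ k := Nat.le_findGreatest hP1le hP1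
  have hmax : ¬ P (k + 1) := by
    intro h
    have hle : k + 1 ≤ cs.length w := by
      obtain ⟨v, -, hv⟩ := h
      omega
    have := Nat.le_findGreatest hle h
    omega
  obtain ⟨v, hvw, hvl⟩ := hPk
  obtain ⟨l, hl⟩ : ∃ l, k = l + 1 := ⟨k - 1, by omega⟩
  have hy : ¬ cs.IsRightDescent v (if Even k then j else i) := by
    intro h
    refine hmax ⟨v * cs.simple (if Even k then j else i), ?_, ?_⟩
    · rw [halt_succ, mul_assoc, cs.simple_mul_simple_cancel_left, hvw]
    · have := cs.isRightDescent_iff.mp h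
      omega
  have hx : ¬ cs.IsRightDescent v (if Even l then j else i) := by
    intro h
    have h1 := cs.isRightDescent_iff.mp h
    have h2 : (v * cs.simple (if Even l then j else i)) * alt l = w := by
      rw [mul_assoc, ← halt_succ, ← hl, hvw]
    have h3 := cs.length_mul_le (v * cs.simple (if Even l then j else i)) (alt l)
    rw [h2] at h3
    have := halt l
    omega
  have hv_both : ¬ cs.IsRightDescent v i ∧ ¬ cs.IsRightDescent v j := by
    by_cases he : Even l
    · have he' : ¬ Even k := by simpa [hl, Nat.even_add_one] using he
      rw [if_neg he'] at hy
      rw [if_pos he] at hx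
      exact ⟨hy, hx⟩
    · have he' : Even k := by simpa [hl, Nat.even_add_one] using he
      rw [if_pos he'] at hy
      rw [if_neg he] at hx
      exact ⟨hx, hy⟩
  have hvi := ih (cs.length v) (by omega) v i hv_both.1 rfl
  have hvj := ih (cs.length v) (by omega) v j hv_both.2 rfl
  have hkM : M i j = 0 ∨ k + 1 ≤ M i j := by
    by_contra! hcon
    have hred := cs.not_isReduced_alternatingWord j i (m := k + 1)
      (by rw [M.symmetric]; exact hcon.1) (by rw [M.symmetric]; exact hcon.2)
    apply hred
    have hword : cs.wordProd (CoxeterSystem.alternatingWord j i (k + 1)) = alt k * cs.simple i := by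
      rw [CoxeterSystem.alternatingWord_succ, cs.wordProd_concat]
    have h1 := cs.not_isRightDescent_iff.mp hw
    have h2 := cs.length_mul_le v (alt k * cs.simple i)
    rw [← mul_assoc, hvw, h1, ← hword] at h2
    have h3 := cs.length_wordProd_le (CoxeterSystem.alternatingWord j i (k + 1))
    rw [CoxeterSystem.length_alternatingWord] at h3
    rw [CoxeterSystem.IsReduced, CoxeterSystem.length_alternatingWord]
    omega
  have p1 := sinQuot_nonneg hij hkM
  have p0 := sinQuot_nonneg hij (k := k) (hkM.imp_right (by omega))
  rw [← hvw, geomRep_mul_apply, geomRep_alternatingWord cs (neg_neg (formEntry M i j)).symm]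
  split_ifs
  · rw [map_add, map_smul, map_smul]
    exact add_nonneg (smul_nonneg p1 hvi) (smul_nonneg p0 hvj)
  · rw [map_add, map_smul, map_smul]
    exact add_nonneg (smul_nonneg p0 hvi) (smul_nonneg p1 hvj)

lemma geomRep_single_nonpos (w : W) (i : B) (hw : cs.IsRightDescent w i) :
    geomRep cs w (Pi.single i 1) ≤ 0 := by
  have h := geomRep_single_nonneg cs (w * cs.simple i) i
    (cs.isRightDescent_iff_not_isRightDescent_mul.mp hw)
  rw [geomRep_mul_apply, geomRep_simple, refl_self M (form_single_self M i), map_neg] at h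
  exact neg_nonneg.mp h

lemma nonneg_or_nonpos_of_mem_roots {v : B → ℝ} (hv : v ∈ roots cs) : 0 ≤ v ∨ v ≤ 0 := by
  obtain ⟨g, i, rfl⟩ := hv
  by_cases h : cs.IsRightDescent g i
  · exact Or.inr (geomRep_single_nonpos cs g i h)
  · exact Or.inl (geomRep_single_nonneg cs g i h)

lemma eq_one_of_geomRep_single_eq {w : W}
    (hw : ∀ i, geomRep cs w (Pi.single i 1) = Pi.single i 1) : w = 1 := by
  by_contra h
  obtain ⟨i, hi⟩ := cs.exists_rightDescent_of_ne_one h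
  have := geomRep_single_nonpos cs w i hi
  rw [hw i] at this
  have := this i
  simp at this
  linarith

lemma finite_roots_nonneg_nonpos (w : W) :
    {v ∈ roots cs | 0 ≤ v ∧ geomRep cs w v ≤ 0}.Finite := by
  induction w using cs.simple_induction_right with
  | one =>
    convert Set.finite_empty
    ext v
    simp only [Set.mem_ofPred_eq, Set.mem_empty_iff_false, iff_false]
    rintro ⟨hv, h0, h1⟩
    rw [map_one, Module.End.one_apply] at h1
    have := form_self_of_mem_roots cs hv
    rw [le_antisymm h1 h0] at this
    simp at this
  | mul_simple_right w i ih =>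
    refine ((ih.image (geomRep cs (cs.simple i))).union
      (Set.finite_singleton (Pi.single i (1 : ℝ)))).subset ?_
    rintro v ⟨hv, h0, h1⟩
    rw [geomRep_mul_apply] at h1
    have hv' := geomRep_mem_roots cs (cs.simple i) hv
    have hvv : geomRep cs (cs.simple i) (geomRep cs (cs.simple i) v) = v := by
      simpa using geomRep_inv_apply cs (cs.simple i) v
    rcases nonneg_or_nonpos_of_mem_roots cs hv' with h | h
    · exact Or.inl ⟨_, ⟨hv', h, h1⟩, hvv⟩
    · right
      rw [geomRep_simple, refl_apply] at h
      have hvi : v = v i • Pi.single i 1 := by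
        ext j
        rcases eq_or_ne j i with rfl | hji
        · simp
        · have := h j
          have h0j := h0 j
          simp [hji] at this h0j ⊢
          exact le_antisymm this h0j
      have h1 := form_self_of_mem_roots cs hv
      rw [hvi] at h1
      simp only [map_smul, LinearMap.smul_apply, form_single_self, smul_eq_mul] at h1
      have h0i : 0 ≤ v i := h0 i
      have : v i = 1 := by nlinarith
      rw [Set.mem_singleton_iff, hvi, this, one_smul]

lemma finite_of_finite_roots (h : (roots cs).Finite) : Finite W := by
  have := h.to_subtype
  refine Finite.of_injective
    (fun (w : W) (i : B) => (⟨geomRep cs w (Pi.single i 1), w, i, rfl⟩ : roots cs)) ?_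
  intro g g' hgg
  have : g'⁻¹ * g = 1 := by
    refine eq_one_of_geomRep_single_eq cs fun i => ?_
    have hi : geomRep cs g (Pi.single i 1) = geomRep cs g' (Pi.single i 1) :=
      congrArg Subtype.val (congrFun hgg i)
    rw [geomRep_mul_apply, hi, geomRep_inv_apply]
  exact (inv_mul_eq_one.mp this).symm

/-- In an infinite Coxeter group, no element acts as `-1` in the geometric representation. -/
lemma finite_of_geomRep_single_eq_neg {w : W}
    (hw : ∀ i, geomRep cs w (Pi.single i 1) = -Pi.single i 1) : Finite W := by
  have hneg (v : B → ℝ) : geomRep cs w v = -v := by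
    conv_lhs => rw [eq_sum_single v]
    conv_rhs => rw [eq_sum_single v]
    simp only [map_sum, map_smul, hw, smul_neg, Finset.sum_neg_distrib]
  have hfin := finite_roots_nonneg_nonpos cs w
  refine finite_of_finite_roots cs ((hfin.union (hfin.image Neg.neg)).subset fun v hv => ?_)
  rcases nonneg_or_nonpos_of_mem_roots cs hv with h | h
  · exact Or.inl ⟨hv, h, by rw [hneg]; exact neg_nonpos.mpr h⟩
  · exact Or.inr ⟨-v, ⟨neg_mem_roots cs hv, neg_nonneg.mpr h, by
      rw [hneg, neg_neg]; exact h⟩, neg_neg v⟩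

end Representation

section Unbounded

variable {B W : Type*} [Fintype B] [DecidableEq B] [Group W] {M : CoxeterMatrix B}

lemma exists_neg_eigenvector (h : ¬ IsPosSemidef M) :
    ∃ (u : B → ℝ) (l : ℝ), u ≠ 0 ∧ l < 0 ∧ ∀ i, form M (Pi.single i 1) u = l * u i := by
  have hA : (Matrix.of (formEntry M)).IsHermitian := by
    ext i j
    simp [formEntry_symm M i j]
  have hneg : ¬ (0 : B → ℝ) ≤ hA.eigenvalues := by
    rw [← hA.posSemidef_iff_eigenvalues_nonneg]
    intro hP
    refine h fun v => (hP.dotProduct_mulVec_nonneg v).trans_eq ?_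
    simp only [dotProduct, Matrix.mulVec, bilin, Finset.mul_sum, Pi.star_apply, star_trivial,
      Matrix.of_apply]
    exact Finset.sum_congr rfl fun i _ => Finset.sum_congr rfl fun j _ => by ring
  obtain ⟨k, hk⟩ : ∃ k, hA.eigenvalues k < 0 := by
    by_contra! hcon
    exact hneg hcon
  refine ⟨hA.eigenvectorBasis k, hA.eigenvalues k, ?_, hk, fun i => ?_⟩
  · intro h0
    exact hA.eigenvectorBasis.toBasis.ne_zero k (by
      rw [OrthonormalBasis.coe_toBasis]
      ext i
      exact congrFun h0 i)
  · have := congrFun (hA.mulVec_eigenvectorBasis k) i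
    rw [Pi.smul_apply, smul_eq_mul] at this
    rw [← this]
    simp [form_apply, Pi.single_apply, Matrix.mulVec, dotProduct, mul_comm]

variable (cs : CoxeterSystem M W)

lemma not_bounded_form_roots (h : ¬ IsPosSemidef M) :
    ¬ ∃ C, ∀ v ∈ roots cs, ∀ i, |form M v (Pi.single i 1)| ≤ C := by
  rintro ⟨C, hC⟩
  obtain ⟨u, l, hu, hl, hform⟩ := exists_neg_eigenvector h
  let f (v : B → ℝ) : ℝ := -form M v u
  have hfs (i : B) : f (Pi.single i 1) = -l * u i := by simp [f, hform]
  have hf (v : B → ℝ) : f v = ∑ i, u i * -form M v (Pi.single i 1) := by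
    simp only [f]
    conv_lhs => rw [eq_sum_single u]
    simp only [map_sum, map_smul, smul_eq_mul, mul_neg, Finset.sum_neg_distrib]
  have hbdd : BddAbove (f '' roots cs) := by
    refine ⟨∑ i, |u i| * C, ?_⟩
    rintro _ ⟨v, hv, rfl⟩
    rw [hf]
    refine Finset.sum_le_sum fun i _ => (le_abs_self _).trans ?_
    rw [abs_mul, abs_neg]
    exact mul_le_mul_of_nonneg_left (hC v hv i) (abs_nonneg _)
  set F := sSup (f '' roots cs) with hF
  have hle {v : B → ℝ} (hv : v ∈ roots cs) : f v ≤ F := le_csSup hbdd ⟨v, hv, rfl⟩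
  obtain ⟨i, hi⟩ : ∃ i, u i ≠ 0 := by
    by_contra! hcon
    exact hu (funext hcon)
  have hFpos : 0 < F := by
    have h1 := hle (single_mem_roots cs i)
    have h2 := hle (neg_mem_roots cs (single_mem_roots cs i))
    have h3 : f (-Pi.single i 1) = -f (Pi.single i 1) := by simp [f]
    rw [h3] at h2
    rw [hfs] at h1 h2
    rcases lt_or_gt_of_ne hi with h | h <;> nlinarith
  have hN : 0 ≤ (Fintype.card B : ℝ) / (-(2 * l)) := div_nonneg (by positivity) (by linarith)
  set N := (Fintype.card B : ℝ) / (-(2 * l)) with hNdef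
  set ε := F / (2 * (N + 1)) with hε
  have hεpos : 0 < ε := by positivity
  obtain ⟨_, ⟨v, hv, rfl⟩, hvF⟩ :=
    exists_lt_of_lt_csSup ⟨_, Set.mem_image_of_mem f (single_mem_roots cs i)⟩
      (show F - ε < sSup (f '' roots cs) by rw [← hF]; linarith)
  have hbound (j : B) : u j * -form M v (Pi.single j 1) ≤ ε / (-(2 * l)) := by
    have h1 := hle (refl_mem_roots cs (single_mem_roots cs j) hv)
    have h2 : f (refl M (Pi.single j 1) v) =
        f v - 2 * form M v (Pi.single j 1) * f (Pi.single j 1) := by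
      simp only [f, refl_apply, form_symm M (Pi.single j 1) v, map_sub, map_smul,
        LinearMap.sub_apply, LinearMap.smul_apply, smul_eq_mul]
      ring
    rw [h2, hfs] at h1
    rw [le_div_iff₀ (by linarith)]
    linarith
  have hsum : f v ≤ N * ε := by
    rw [hf]
    refine (Finset.sum_le_sum fun j _ => hbound j).trans_eq ?_
    rw [Finset.sum_const, Finset.card_univ, nsmul_eq_mul, hNdef]
    ring
  have : ε * (2 * (N + 1)) = F := by
    rw [hε]
    field_simp
  nlinarith

lemma not_bounded_form_single (hirr : IsIrreducible M) (h : ¬ IsPosSemidef M) (i : B) :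
    ¬ ∃ C, ∀ v ∈ roots cs, |form M v (Pi.single i 1)| ≤ C := by
  intro hi
  have hall := forall_of_adj hirr
    (p := fun j => ∃ C, ∀ v ∈ roots cs, |form M v (Pi.single j 1)| ≤ C) hi (by
      rintro j k hjk ⟨C, hC⟩
      refine ⟨2 * C / (2 * |formEntry M j k|), fun v hv => ?_⟩
      have h1 := hC v hv
      have h2 := hC _ (refl_mem_roots cs (single_mem_roots cs k) hv)
      rw [refl_apply] at h2
      simp only [map_sub, map_smul, LinearMap.sub_apply, LinearMap.smul_apply, smul_eq_mul,
        form_single, form_symm M (Pi.single k 1) v, formEntry_symm M k j] at h2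
      rw [le_div_iff₀ (by positivity)]
      calc |form M v (Pi.single k 1)| * (2 * |formEntry M j k|)
          = |2 * form M v (Pi.single k 1) * formEntry M j k| := by
            rw [abs_mul, abs_mul, abs_two]
            ring
        _ ≤ 2 * C := by
            rw [abs_le] at h1 h2 ⊢
            constructor <;> linarith)
  choose C hC using hall
  refine not_bounded_form_roots cs h ⟨∑ j, |C j|, fun v hv j => (hC j v hv).trans ?_⟩
  exact (le_abs_self _).trans
    (Finset.single_le_sum (f := fun j => |C j|) (fun _ _ => abs_nonneg _) (Finset.mem_univ j))

lemma isPosSemidef_of_card_le_two (h : Fintype.card B ≤ 2) : IsPosSemidef M := by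
  intro v
  have hterm (i j : B) :
      (if i = j then 2 * |v i| ^ 2 else 0) - |v i| * |v j| ≤ v i * v j * formEntry M i j := by
    split_ifs with hij
    · subst hij
      rw [formEntry_self]
      nlinarith [abs_mul_abs_self (v i)]
    · have h1 := neg_one_le_formEntry M i j
      have h2 := formEntry_nonpos M hij
      have h3 : |v i * v j * formEntry M i j| ≤ |v i| * |v j| := by
        rw [abs_mul, abs_mul]
        exact mul_le_of_le_one_right (by positivity) (abs_le.mpr ⟨h1, by linarith⟩)
      linarith [neg_abs_le (v i * v j * formEntry M i j)]
  have hcs := sq_sum_le_card_mul_sum_sq (s := Finset.univ) (f := fun i => |v i|)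
  have hpos : 0 ≤ ∑ i, |v i| ^ 2 := Finset.sum_nonneg fun i _ => by positivity
  have hcard : (Fintype.card B : ℝ) ≤ 2 := by exact_mod_cast h
  calc (0 : ℝ) ≤ 2 * ∑ i, |v i| ^ 2 - (∑ i, |v i|) ^ 2 := by
        rw [Finset.card_univ] at hcs
        nlinarith
    _ = ∑ i, ∑ j, ((if i = j then 2 * |v i| ^ 2 else 0) - |v i| * |v j|) := by
        rw [sq (∑ i, |v i|), Finset.sum_mul_sum]
        simp [Finset.sum_sub_distrib, ← Finset.mul_sum]
    _ ≤ bilin M v v := Finset.sum_le_sum fun i _ => Finset.sum_le_sum fun j _ => hterm i j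

end Unbounded

section FiniteConjugacyClass

variable {B W : Type*} [Fintype B] [DecidableEq B] [Group W] {M : CoxeterMatrix B}

lemma exists_pow_commute {G : Type*} [Group G] {w : G}
    (hw : (Set.range fun g : G => g * w * g⁻¹).Finite) (h : G) :
    ∃ n : ℕ, n ≠ 0 ∧ w * h ^ n = h ^ n * w := by
  have := hw.to_subtype
  obtain ⟨m, n, hmn, heq⟩ := Finite.exists_ne_map_eq_of_infinite
    (fun n : ℕ => (⟨h ^ n * w * (h ^ n)⁻¹, h ^ n, rfl⟩ : Set.range fun g : G => g * w * g⁻¹))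
  have heq : h ^ m * w * (h ^ m)⁻¹ = h ^ n * w * (h ^ n)⁻¹ := congrArg Subtype.val heq
  wlog hlt : m < n generalizing m n
  · exact this n m hmn.symm (Subtype.ext heq.symm) heq.symm (by omega)
  refine ⟨n - m, by omega, ?_⟩
  have hn : h ^ n = h ^ m * h ^ (n - m) := by rw [← pow_add]; congr 1; omega
  rw [hn] at heq
  have h2 : w * (h ^ m)⁻¹ = h ^ (n - m) * w * (h ^ (n - m))⁻¹ * (h ^ m)⁻¹ := by
    simpa [mul_assoc] using heq
  have h1 : w = h ^ (n - m) * w * (h ^ (n - m))⁻¹ := mul_right_cancel h2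
  conv_lhs => rw [h1]
  group

variable (cs : CoxeterSystem M W)

lemma geomRep_pow_sub_mem_span {a b : B → ℝ} {h : W}
    (hh : geomRep cs h = refl M a * refl M b) (n : ℕ) (v : B → ℝ) :
    geomRep cs (h ^ n) v - v ∈ Submodule.span ℝ {a, b} := by
  have ha : a ∈ Submodule.span ℝ {a, b} := Submodule.subset_span (by simp)
  have hb : b ∈ Submodule.span ℝ {a, b} := Submodule.subset_span (by simp)
  induction n with
  | zero => simp
  | succ n ih =>
    have key (z : B → ℝ) : geomRep cs h z - z ∈ Submodule.span ℝ {a, b} := by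
      rw [hh, Module.End.mul_apply, refl_apply M a, refl_apply M b, sub_right_comm,
        sub_sub_cancel_left]
      exact sub_mem (neg_mem (Submodule.smul_mem _ _ hb)) (Submodule.smul_mem _ _ ha)
    rw [pow_succ', geomRep_mul_apply, ← sub_add_sub_cancel _ (geomRep cs (h ^ n) v)]
    exact add_mem (key _) ih

/-- An element with finite conjugacy class preserves the plane spanned by two roots
generating a hyperbolic plane. -/
lemma geomRep_mem_span {w : W} (hw : (Set.range fun g : W => g * w * g⁻¹).Finite)
    {a b : B → ℝ} (ha : a ∈ roots cs) (hb : b ∈ roots cs) (hab : 1 < |form M a b|) :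
    geomRep cs w a ∈ Submodule.span ℝ {a, b} := by
  obtain ⟨s, hs⟩ := exists_geomRep_eq_refl cs ha
  obtain ⟨t, ht⟩ := exists_geomRep_eq_refl cs hb
  have hh : geomRep cs (s * t) = refl M a * refl M b := by rw [map_mul, hs, ht]
  obtain ⟨n, hn, hcomm⟩ := exists_pow_commute hw (s * t)
  have eig {x y : ℝ} (hadd : x + y = 2 * form M a b) (hmul : x * y = 1) :
      geomRep cs w (a - x • b) ∈ Submodule.span ℝ {a, b} := by
    have hy : y ^ 2 ≠ 1 := by
      intro hy
      have hxy : x = y := by linear_combination y * hmul - x * hy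
      have h2 : (x + y) ^ 2 = 4 := by
        rw [hxy]
        linear_combination 4 * hy
      rw [hadd] at h2
      have h3 : 1 < form M a b ^ 2 := (one_lt_sq_iff_one_lt_abs _).mpr hab
      linarith
    have hyn : (y ^ 2) ^ n ≠ 1 := fun h => hy ((pow_eq_one_iff_of_nonneg (sq_nonneg y) hn).mp h)
    have hpow (k : ℕ) : geomRep cs ((s * t) ^ k) (a - x • b) = ((y ^ 2) ^ k) • (a - x • b) := by
      induction k with
      | zero => simp
      | succ k ih =>
        rw [pow_succ', geomRep_mul_apply, ih, map_smul, hh, Module.End.mul_apply,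
          refl_refl_sub_smul M (form_self_of_mem_roots cs ha) (form_self_of_mem_roots cs hb)
            hadd hmul, smul_smul, ← pow_succ]
    have h1 := geomRep_pow_sub_mem_span cs hh n (geomRep cs w (a - x • b))
    rw [← geomRep_mul_apply, ← hcomm, geomRep_mul_apply, hpow, map_smul] at h1
    rw [← Submodule.smul_mem_iff _ (sub_ne_zero.mpr hyn), sub_smul, one_smul]
    exact h1
  set c := form M a b with hc
  have hd : 0 < c ^ 2 - 1 := by
    have := (one_lt_sq_iff_one_lt_abs c).mpr hab
    linarith
  set r := Real.sqrt (c ^ 2 - 1) with hr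
  have hr0 : 0 < r := Real.sqrt_pos.mpr hd
  have hrr : r ^ 2 = c ^ 2 - 1 := Real.sq_sqrt hd.le
  have e1 := eig (x := c + r) (y := c - r) (by ring) (by linear_combination -hrr)
  have e2 := eig (x := c - r) (y := c + r) (by ring) (by linear_combination -hrr)
  have ha' : (2 * r) • a = (c + r) • (a - (c - r) • b) - (c - r) • (a - (c + r) • b) := by module
  have h2r : 2 * r ≠ 0 := by positivity
  rw [← Submodule.smul_mem_iff _ h2r, ← map_smul, ha', map_sub, map_smul, map_smul]
  exact sub_mem (Submodule.smul_mem _ _ e2) (Submodule.smul_mem _ _ e1)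

/-- A root is orthogonal to a hyperbolic plane as soon as its pairings with the roots of
this plane are bounded. -/
lemma form_eq_zero_of_bounded {a b d : B → ℝ} (ha : a ∈ roots cs) (hb : b ∈ roots cs)
    (hab : 1 < |form M a b|)
    (hbound : ∀ g : W, (∀ x ∈ Submodule.span ℝ {a, b}, geomRep cs g x ∈ Submodule.span ℝ {a, b}) →
      |form M d (geomRep cs g a)| ≤ 1) :
    form M d a = 0 ∧ form M d b = 0 := by
  obtain ⟨s, hs⟩ := exists_geomRep_eq_refl cs ha
  obtain ⟨t, ht⟩ := exists_geomRep_eq_refl cs hb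
  have haa := form_self_of_mem_roots cs ha
  have hbb := form_self_of_mem_roots cs hb
  have hamem : a ∈ Submodule.span ℝ {a, b} := Submodule.subset_span (by simp)
  have hbmem : b ∈ Submodule.span ℝ {a, b} := Submodule.subset_span (by simp)
  have hsP : ∀ x ∈ Submodule.span ℝ {a, b}, geomRep cs s x ∈ Submodule.span ℝ {a, b} := by
    intro x hx
    rw [hs, refl_apply]
    exact sub_mem hx (Submodule.smul_mem _ _ hamem)
  have htP : ∀ x ∈ Submodule.span ℝ {a, b}, geomRep cs t x ∈ Submodule.span ℝ {a, b} := by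
    intro x hx
    rw [ht, refl_apply]
    exact sub_mem hx (Submodule.smul_mem _ _ hbmem)
  set c := form M a b with hc
  have hc2 : 1 < c ^ 2 := (one_lt_sq_iff_one_lt_abs c).mpr hab
  have htrace : ∀ x ∈ Submodule.span ℝ {a, b},
      geomRep cs s (geomRep cs t x) + geomRep cs t (geomRep cs s x) = (4 * c ^ 2 - 2) • x := by
    intro x hx
    obtain ⟨p, q, rfl⟩ := Submodule.mem_span_pair.mp hx
    simp only [hs, ht, refl_apply, map_add, map_sub, map_smul, haa, hbb, ← hc,
      form_symm M b a]
    module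
  have hdecay (n : ℕ) : ∀ g : W,
      (∀ x ∈ Submodule.span ℝ {a, b}, geomRep cs g x ∈ Submodule.span ℝ {a, b}) →
      |form M d (geomRep cs g a)| ≤ (2 / (4 * c ^ 2 - 2)) ^ n := by
    induction n with
    | zero => simpa using hbound
    | succ n ih =>
      intro g hg
      have h1 := ih (s * (t * g)) fun x hx => by
        rw [geomRep_mul_apply, geomRep_mul_apply]
        exact hsP _ (htP _ (hg x hx))
      have h2 := ih (t * (s * g)) fun x hx => by
        rw [geomRep_mul_apply, geomRep_mul_apply]
        exact htP _ (hsP _ (hg x hx))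
      have h3 := congrArg (form M d) (htrace _ (hg a hamem))
      rw [map_add, map_smul, smul_eq_mul] at h3
      rw [geomRep_mul_apply, geomRep_mul_apply] at h1 h2
      have hpos : 0 < 4 * c ^ 2 - 2 := by linarith
      rw [pow_succ, mul_div_assoc', le_div_iff₀ hpos]
      calc |form M d (geomRep cs g a)| * (4 * c ^ 2 - 2)
          = |(4 * c ^ 2 - 2) * form M d (geomRep cs g a)| := by
            rw [abs_mul, abs_of_pos hpos, mul_comm]
        _ ≤ (2 / (4 * c ^ 2 - 2)) ^ n * 2 := by
            rw [← h3]
            exact (abs_add_le _ _).trans (by linarith)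
  have hzero (g : W)
      (hg : ∀ x ∈ Submodule.span ℝ {a, b}, geomRep cs g x ∈ Submodule.span ℝ {a, b}) :
      form M d (geomRep cs g a) = 0 := by
    have hlim := tendsto_pow_atTop_nhds_zero_of_lt_one
      (r := 2 / (4 * c ^ 2 - 2)) (div_nonneg two_pos.le (by linarith))
      (by rw [div_lt_one (by linarith)]; linarith)
    exact abs_nonpos_iff.mp (ge_of_tendsto' hlim fun n => hdecay n g hg)
  have h1 : form M d a = 0 := by simpa using hzero 1 (by simp)
  refine ⟨h1, ?_⟩
  have h2 := hzero t htP
  rw [ht, refl_apply, map_sub, map_smul, h1, form_symm M b a, ← hc, smul_eq_mul, zero_sub,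
    neg_eq_zero] at h2
  refine (mul_eq_zero.mp h2).resolve_left fun h => ?_
  have : c = 0 := by linarith
  rw [this] at hc2
  norm_num at hc2

/-- An element with finite conjugacy class preserves the line spanned by any simple root. -/
lemma exists_geomRep_single_eq_smul (hirr : IsIrreducible M) (hM : ¬ IsPosSemidef M) {w : W}
    (hw : (Set.range fun g : W => g * w * g⁻¹).Finite) (i : B) :
    ∃ c : ℝ, c • Pi.single i 1 = geomRep cs w (Pi.single i 1) := by
  rw [← Submodule.mem_span_singleton]
  by_contra hline
  set a : B → ℝ := Pi.single i 1 with ha_def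
  have ha : a ∈ roots cs := single_mem_roots cs i
  obtain ⟨b, hb, hba⟩ : ∃ b ∈ roots cs, 1 < |form M b a| := by
    by_contra! hcon
    exact not_bounded_form_single cs hirr hM i ⟨1, hcon⟩
  have hab : 1 < |form M a b| := by rwa [form_symm]
  set P := Submodule.span ℝ {a, b} with hP
  have haP : a ∈ P := Submodule.subset_span (by simp)
  have hbP : b ∈ P := Submodule.subset_span (by simp)
  have hwa : geomRep cs w a ∈ P := geomRep_mem_span cs hw ha hb hab
  have hyp {d : B → ℝ} (hd : d ∈ roots cs) (had : 1 < |form M a d|) : d ∈ P := by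
    obtain ⟨p, q, hpq⟩ := Submodule.mem_span_pair.mp (geomRep_mem_span cs hw ha hd had)
    have hq : q ≠ 0 := by
      rintro rfl
      exact hline (Submodule.mem_span_singleton.mpr ⟨p, by simpa using hpq⟩)
    rw [← Submodule.smul_mem_iff _ hq, eq_sub_of_add_eq' hpq]
    exact sub_mem hwa (Submodule.smul_mem _ _ haP)
  have hdich {d : B → ℝ} (hd : d ∈ roots cs) (hdP : d ∉ P) : form M d a = 0 ∧ form M d b = 0 := by
    refine form_eq_zero_of_bounded cs ha hb hab fun g hg => ?_
    by_contra! hlt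
    refine hdP ?_
    rw [← geomRep_apply_inv cs g d] at hlt ⊢
    rw [form_geomRep, form_symm] at hlt
    exact hg _ (hyp (geomRep_mem_roots cs g⁻¹ hd) hlt)
  have hall : ∀ j, (Pi.single j 1 : B → ℝ) ∈ P := by
    refine forall_of_adj hirr (p := fun j => (Pi.single j 1 : B → ℝ) ∈ P) haP fun j k hjk hj => ?_
    by_contra hk
    obtain ⟨h1, h2⟩ := hdich (single_mem_roots cs k) hk
    obtain ⟨p, q, hpq⟩ := Submodule.mem_span_pair.mp hj
    refine hjk ?_
    rw [formEntry_symm, ← form_single, ← hpq, map_add, map_smul, map_smul, h1, h2]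
    simp
  have htop : P = ⊤ := by
    refine eq_top_iff.mpr fun v _ => ?_
    rw [eq_sum_single v]
    exact Submodule.sum_mem _ fun j _ => Submodule.smul_mem _ _ (hall j)
  refine hM (isPosSemidef_of_card_le_two ?_)
  have h1 : Module.finrank ℝ P ≤ 2 := by
    have := finrank_span_finset_le_card (R := ℝ) ({a, b} : Finset (B → ℝ))
    rw [Finset.coe_pair] at this
    exact this.trans Finset.card_le_two
  rwa [htop, finrank_top, Module.finrank_fintype_fun_eq_card] at h1

theorem eq_one_of_finite_conjugacyClass (cs : CoxeterSystem M W) (hirr : IsIrreducible M)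
    (hinf : Infinite W) (hM : ¬ IsPosSemidef M) {w : W}
    (hw : (Set.range fun g : W => g * w * g⁻¹).Finite) :
    w = 1 := by
  choose c hc using exists_geomRep_single_eq_smul cs hirr hM hw
  have hform (i j : B) : c i * c j * formEntry M i j = formEntry M i j := by
    have := form_geomRep cs w (Pi.single i 1) (Pi.single j 1)
    rw [← hc, ← hc, form_single] at this
    simpa [form_single, mul_assoc, mul_left_comm] using this
  have hsq (i : B) : c i * c i = 1 := by simpa [formEntry_self] using hform i i
  obtain ⟨i⟩ := hirr.nonempty
  have hconst : ∀ j, c j = c i := by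
    refine forall_of_adj hirr (p := fun j => c j = c i) rfl fun j k hjk hj => ?_
    have h1 : c j * c k = 1 := by simpa [hjk] using hform j k
    rw [← hj]
    exact mul_left_cancel₀ (left_ne_zero_of_mul_eq_one h1) (h1.trans (hsq j).symm)
  rcases mul_self_eq_one_iff.mp (hsq i) with h | h
  · refine eq_one_of_geomRep_single_eq cs fun j => ?_
    rw [← hc, hconst, h, one_smul]
  · refine absurd (finite_of_geomRep_single_eq_neg cs (w := w) fun j => ?_)
      (not_finite_iff_infinite.mpr hinf)
    rw [← hc, hconst, h, neg_smul, one_smul]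

end FiniteConjugacyClass

lemma center_monoidAlgebra_eq_bot_of_infinite_conjugacyClass {G : Type*} [Group G]
    (hG : ∀ w : G, (Set.range fun g : G => g * w * g⁻¹).Finite → w = 1)
    (R : Type*) [CommRing R] : Subalgebra.center R (MonoidAlgebra R G) = ⊥ := by
  refine eq_bot_iff.mpr fun z hz => ?_
  rw [Subalgebra.mem_center_iff] at hz
  have hconj (g w : G) : z.coeff (g * w * g⁻¹) = z.coeff w := by
    have h := congrArg (fun y => MonoidAlgebra.coeff y (g * w)) (hz (MonoidAlgebra.single g 1))
    simpa using h.symm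
  have hsupp (w : G) (hw : w ≠ 1) : z.coeff w = 0 := by
    by_contra hne
    refine hw (hG w (z.coeff.support.finite_toSet.subset ?_))
    rintro _ ⟨g, rfl⟩
    simpa [hconj] using hne
  refine Algebra.mem_bot.mpr ⟨z.coeff 1, ?_⟩
  ext w
  rcases eq_or_ne w 1 with rfl | hw
  · simp
  · simp [hsupp w hw, hw.symm]

/-- For an irreducible, infinite, non-affine Coxeter group `W` and a
commutative ring `R`, the center of the group ring `R[W]` consists exactly of the
scalar multiples of the identity element of `W`, i.e. it is the bottom subalgebra
(the image of `R`). -/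
theorem center_groupRing_eq_bot
    {B W : Type*} [Fintype B] [Group W] {M : CoxeterMatrix B} (cs : CoxeterSystem M W)
    (hirr : IsIrreducible M) (hinf : Infinite W)
    (hnonaff : ¬ IsPosDef M ∧ ¬ IsPosSemidef M)
    (R : Type*) [CommRing R] :
    Subalgebra.center R (MonoidAlgebra R W) = ⊥ := by
  classical
  exact center_monoidAlgebra_eq_bot_of_infinite_conjugacyClass
    (fun _ hw => eq_one_of_finite_conjugacyClass cs hirr hinf hnonaff.2 hw) R

end CoxeterPaper
end

section
/- Let (W,S) be a Coxeter system of finite rank, T ⊆ S with W_T a finite subgroup, and let w_T be the longest element of W_T. Then for s ∈ S − T, s w_T = w_T s if and only if m_{st} = 2 for all t ∈ T. -/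
namespace CoxeterPaper

section InversionParity

variable {B W : Type*} [Group W] {M : CoxeterMatrix B} (cs : CoxeterSystem M W)

open Classical in
/-- The action of a simple reflection on `W × ZMod 2`: conjugation on the first factor, with the
sign flipped at the simple reflection itself. -/
noncomputable def signedConj (i : B) : Function.End (W × ZMod 2) :=
  fun p => (cs.simple i * p.1 * cs.simple i, p.2 + if p.1 = cs.simple i then 1 else 0)

open Classical in
theorem signedConj_mul_signedConj_pow_apply (i j : B) (n : ℕ) (r : W) (e : ZMod 2) :
    ((signedConj cs i * signedConj cs j) ^ n) (r, e) =
      ((cs.simple i * cs.simple j) ^ n * r * ((cs.simple j * cs.simple i) ^ n),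
        e + ∑ l ∈ Finset.range (2 * n),
          if r = (cs.simple j * cs.simple i) ^ l * cs.simple j then 1 else 0) := by
  induction n with
  | zero => simp; rfl
  | succ n ih =>
    have hinv : (cs.simple i * cs.simple j) ^ n = ((cs.simple j * cs.simple i) ^ n)⁻¹ := by
      rw [← inv_pow, mul_inv_rev, cs.inv_simple, cs.inv_simple]
    have hcomm : cs.simple j * (cs.simple i * cs.simple j) ^ n =
        (cs.simple j * cs.simple i) ^ n * cs.simple j :=
      SemiconjBy.pow_right (show SemiconjBy _ _ _ by simp [SemiconjBy, mul_assoc]) n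
    set a := cs.simple i * cs.simple j with ha
    set b := cs.simple j * cs.simple i with hb
    have h₁ : a ^ n * r * b ^ n = cs.simple j ↔ r = b ^ (2 * n) * cs.simple j := by
      rw [two_mul, pow_add, mul_assoc (b ^ n), ← hcomm, hinv, ← mul_assoc,
        ← eq_mul_inv_iff_mul_eq, inv_mul_eq_iff_eq_mul, mul_assoc]
    have h₂ : cs.simple j * (a ^ n * r * b ^ n) * cs.simple j = cs.simple i ↔
        r = b ^ (2 * n + 1) * cs.simple j := by
      have e₁ : b ^ (2 * n + 1) * cs.simple j
          = b ^ n * (cs.simple j * cs.simple i * cs.simple j) * (b ^ n)⁻¹ := by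
        rw [show 2 * n + 1 = n + 1 + n by ring, pow_add, pow_succ, mul_assoc _ (b ^ n), ← hcomm,
          hinv, hb]
        simp only [mul_assoc]
      rw [e₁, hinv]
      constructor
      · intro h
        rw [← h]
        simp [mul_assoc]
      · rintro rfl
        simp [mul_assoc]
    rw [pow_succ']
    change signedConj cs i (signedConj cs j (((signedConj cs i * signedConj cs j) ^ n) (r, e))) = _
    rw [ih]
    simp only [signedConj, h₁, h₂]
    rw [show 2 * (n + 1) = 2 * n + 1 + 1 by ring, Finset.sum_range_succ, Finset.sum_range_succ,
      pow_succ' a, pow_succ b]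
    ext
    · simp [ha, hb, mul_assoc, pow_succ]
    · simp [add_assoc]

theorem isLiftable_signedConj : M.IsLiftable (signedConj cs) := by
  classical
  intro i j
  funext ⟨r, e⟩
  rw [signedConj_mul_signedConj_pow_apply, two_mul, Finset.sum_range_add]
  simp [pow_add, CharTwo.add_self_eq_zero]
  rfl

/-- The action of `W` on `W × ZMod 2` by signed conjugation. -/
noncomputable def signedConjHom : W →* Function.End (W × ZMod 2) :=
  cs.lift ⟨signedConj cs, isLiftable_signedConj cs⟩

/-- For a reflection `r`, this is `1` if `r` is a right inversion of `w` and `0` otherwise. -/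
noncomputable def inversionParity (w r : W) : ZMod 2 := (signedConjHom cs w (r, 0)).2

open Classical in
theorem signedConjHom_simple_apply (i : B) (p : W × ZMod 2) :
    signedConjHom cs (cs.simple i) p =
      (cs.simple i * p.1 * cs.simple i, p.2 + if p.1 = cs.simple i then 1 else 0) := by
  rw [signedConjHom, cs.lift_apply_simple]; rfl

theorem signedConjHom_apply (w r : W) (e : ZMod 2) :
    signedConjHom cs w (r, e) = (w * r * w⁻¹, e + inversionParity cs w r) := by
  induction w using cs.simple_induction_left generalizing r e with
  | one => simp [inversionParity, Function.End.one_def]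
  | mul_simple_left w i ih =>
    have hmul (p : W × ZMod 2) : signedConjHom cs (cs.simple i * w) p =
        signedConjHom cs (cs.simple i) (signedConjHom cs w p) := by rw [map_mul]; rfl
    simp only [inversionParity, hmul]
    rw [ih, ih]
    simp [signedConjHom_simple_apply, mul_assoc, add_assoc]

theorem inversionParity_mul (u v r : W) :
    inversionParity cs (u * v) r =
      inversionParity cs v r + inversionParity cs u (v * r * v⁻¹) := by
  have hmul : signedConjHom cs (u * v) (r, 0) =
      signedConjHom cs u (signedConjHom cs v (r, 0)) := by rw [map_mul]; rfl
  rw [inversionParity, hmul, signedConjHom_apply, signedConjHom_apply]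
  simp

open Classical in
theorem inversionParity_simple (i : B) (r : W) :
    inversionParity cs (cs.simple i) r = if r = cs.simple i then 1 else 0 := by
  simp [inversionParity, signedConjHom_simple_apply]

theorem inversionParity_one (r : W) : inversionParity cs 1 r = 0 := by
  simp [inversionParity, Function.End.one_def]

theorem mem_rightInvSeq_of_inversionParity_ne_zero (ω : List B) (r : W)
    (h : inversionParity cs (cs.wordProd ω) r ≠ 0) : r ∈ cs.rightInvSeq ω := by
  induction ω with
  | nil => simp [inversionParity_one] at h
  | cons i ω ih =>
    rw [cs.wordProd_cons, inversionParity_mul, inversionParity_simple] at h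
    rw [CoxeterSystem.rightInvSeq, List.mem_cons]
    by_cases hr : cs.wordProd ω * r * (cs.wordProd ω)⁻¹ = cs.simple i
    · left
      rw [← hr]
      group
    · right
      exact ih (by simpa [hr] using h)

theorem length_mul_lt_of_inversionParity_ne_zero {w r : W} (h : inversionParity cs w r ≠ 0) :
    cs.length (w * r) < cs.length w := by
  obtain ⟨ω, hω, rfl⟩ := cs.exists_isReduced w
  exact (cs.isRightInversion_of_mem_rightInvSeq hω
    (mem_rightInvSeq_of_inversionParity_ne_zero cs ω r h)).2

theorem inversionParity_ne_zero_of_isRightDescent {w : W} {i : B} (h : cs.IsRightDescent w i) :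
    inversionParity cs w (cs.simple i) ≠ 0 := by
  have h₀ : inversionParity cs (w * cs.simple i) (cs.simple i) = 0 := by
    by_contra h'
    have := length_mul_lt_of_inversionParity_ne_zero cs h'
    rw [cs.simple_mul_simple_cancel_right] at this
    exact lt_asymm this h
  rw [← cs.simple_mul_simple_cancel_right (w := w) i, inversionParity_mul, inversionParity_simple]
  simp [h₀]

theorem mem_closure_of_inversionParity_ne_zero {T : Set B} {w r : W}
    (hw : w ∈ Subgroup.closure (cs.simple '' T)) (h : inversionParity cs w r ≠ 0) :
    r ∈ Subgroup.closure (cs.simple '' T) := by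
  induction hw using Subgroup.closure_induction generalizing r with
  | mem x hx =>
    obtain ⟨t, ht, rfl⟩ := hx
    rw [inversionParity_simple] at h
    have hr : r = cs.simple t := by
      by_contra h'
      simp [h'] at h
    exact hr ▸ Subgroup.subset_closure ⟨t, ht, rfl⟩
  | one => simp [inversionParity_one] at h
  | mul x y hx hy ihx ihy =>
    rw [inversionParity_mul] at h
    by_cases hr : inversionParity cs y r = 0
    · rw [hr, zero_add] at h
      have := ihx h
      rwa [Subgroup.mul_mem_cancel_right _ (inv_mem hy), Subgroup.mul_mem_cancel_left _ hy] at this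
    · exact ihy hr
  | inv x hx ih =>
    have hsum := inversionParity_mul cs x x⁻¹ r
    rw [mul_inv_cancel, inversionParity_one] at hsum
    have := ih (r := x⁻¹ * r * x⁻¹⁻¹) (fun h' => h (by rw [h', add_zero] at hsum; exact hsum.symm))
    rwa [Subgroup.mul_mem_cancel_right _ (inv_mem (inv_mem hx)),
      Subgroup.mul_mem_cancel_left _ (inv_mem hx)] at this

/-- If a simple reflection commutes with an element `w` of a special subgroup, then conjugation by
it sends right descents of `w` into this special subgroup. -/
theorem conj_mem_closure_of_commute {T : Set B} {w : W}
    (hw : w ∈ Subgroup.closure (cs.simple '' T)) {i t : B}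
    (hcomm : cs.simple i * w = w * cs.simple i) (ht : cs.IsRightDescent w t) :
    cs.simple i * cs.simple t * cs.simple i ∈ Subgroup.closure (cs.simple '' T) := by
  refine mem_closure_of_inversionParity_ne_zero cs hw ?_
  have h := congrArg (inversionParity cs · (cs.simple t)) hcomm
  simp only [inversionParity_mul, inversionParity_simple, cs.inv_simple] at h
  have hiff : w * cs.simple t * w⁻¹ = cs.simple i ↔ cs.simple t = cs.simple i := by
    rw [mul_inv_eq_iff_eq_mul, hcomm, mul_right_inj]
  rw [hiff, add_comm, add_right_inj] at h
  rw [← h]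
  exact inversionParity_ne_zero_of_isRightDescent cs ht

end InversionParity

section GeometricRepresentation

open Module Real Polynomial.Chebyshev

theorem reflection_mul_reflection_pow_eq_one {V : Type*} [AddCommGroup V] [Module ℝ V]
    {x y : V} {f g : Dual ℝ V} (hf : f x = 2) (hg : g y = 2) {m : ℕ} (hm : 3 ≤ m)
    (h : f y * g x = 4 * cos (π / m) ^ 2) :
    (reflection hf * reflection hg) ^ m = 1 := by
  have hm0 : (0 : ℝ) < m := by positivity
  set θ : ℝ := 2 * (π / m) with hθ
  have ht : f y * g x - 2 = 2 * cos θ := by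
    rw [h, hθ, cos_two_mul]; ring
  have hmθ : (m : ℝ) * θ = 2 * π := by
    rw [hθ]; field_simp
  have hsin : sin θ ≠ 0 := by
    refine (sin_pos_of_pos_of_lt_pi (by positivity) ?_).ne'
    have : (3 : ℝ) ≤ m := by exact_mod_cast hm
    nlinarith [pi_pos]
  have hS (n : ℤ) : (S ℝ n).eval (2 * cos θ) = sin ((n + 1) * θ) / sin θ := by
    rw [eq_div_iff hsin, S_two_mul_real_cos]
  ext z
  rw [reflection_mul_reflection_pow_apply hf hg m z _ ht.symm]
  obtain ⟨k, rfl | rfl⟩ := Nat.even_or_odd' m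
  · have e₁ : (((2 * k : ℕ) : ℤ) - 2) / 2 = k - 1 := by omega
    have e₂ : (((2 * k : ℕ) : ℤ) - 1) / 2 = k - 1 := by omega
    have hz : (S ℝ ((k : ℤ) - 1)).eval (2 * cos θ) = 0 := by
      rw [hS]
      push_cast at hmθ ⊢
      rw [show ((k : ℝ) - 1 + 1) * θ = π by linarith, sin_pi, zero_div]
    rw [e₁, e₂, hz]
    simp
  · have e₁ : (((2 * k + 1 : ℕ) : ℤ) - 2) / 2 = k - 1 := by omega
    have e₂ : (((2 * k + 1 : ℕ) : ℤ) - 1) / 2 = k := by omega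
    have e₃ : (((2 * k + 1 : ℕ) : ℤ) - 3) / 2 = k - 1 := by omega
    have e₄ : (((2 * k + 1 : ℕ) : ℤ)) / 2 = k := by omega
    have hz : (S ℝ (k : ℤ)).eval (2 * cos θ) + (S ℝ ((k : ℤ) - 1)).eval (2 * cos θ) = 0 := by
      rw [hS, hS, ← add_div]
      push_cast at hmθ ⊢
      rw [show ((k : ℝ) - 1 + 1) * θ = 2 * π - ((k : ℝ) + 1) * θ by linarith, sin_two_pi_sub]
      simp
    rw [e₁, e₂, e₃, e₄, hz]
    simp

variable {B W : Type*} [Group W] {M : CoxeterMatrix B} (cs : CoxeterSystem M W)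

/-- The linear form `2 * B(α_i, ·)`, where `B` is the canonical bilinear form of `M`. -/
noncomputable def simpleCoroot (M : CoxeterMatrix B) (i : B) : Dual ℝ (B →₀ ℝ) :=
  Finsupp.linearCombination ℝ fun j => -2 * cos (π / M i j)

theorem simpleCoroot_single (i j : B) (c : ℝ) :
    simpleCoroot M i (Finsupp.single j c) = c * (-2 * cos (π / M i j)) := by
  simp [simpleCoroot]

theorem simpleCoroot_single_self (i : B) : simpleCoroot M i (Finsupp.single i 1) = 2 := by
  simp [simpleCoroot_single]

/-- The reflection of `B →₀ ℝ` in the `i`-th simple root. -/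
noncomputable def simpleReflection (M : CoxeterMatrix B) (i : B) :
    (B →₀ ℝ) ≃ₗ[ℝ] (B →₀ ℝ) :=
  reflection (simpleCoroot_single_self (M := M) i)

theorem isLiftable_simpleReflection : M.IsLiftable (simpleReflection M) := by
  intro i j
  obtain h0 | h1 | h2 | h3 : M i j = 0 ∨ M i j = 1 ∨ M i j = 2 ∨ 3 ≤ M i j := by omega
  · rw [h0, pow_zero]
  · obtain rfl : i = j := by
      by_contra h
      exact M.off_diagonal i j h h1
    ext1 z
    rw [h1, pow_one]
    exact involutive_reflection (simpleCoroot_single_self (M := M) i) z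
  · have hi : simpleCoroot M i (Finsupp.single j 1) = 0 := by simp [simpleCoroot_single, h2]
    have hj : simpleCoroot M j (Finsupp.single i 1) = 0 := by
      simp [simpleCoroot_single, M.symmetric j i, h2]
    ext1 z
    rw [h2, pow_two]
    simp only [LinearEquiv.mul_apply, simpleReflection, reflection_apply, map_sub, map_smul, hi, hj,
      simpleCoroot_single_self, LinearEquiv.coe_one, id_eq]
    module
  · refine reflection_mul_reflection_pow_eq_one _ _ h3 ?_
    rw [simpleCoroot_single, simpleCoroot_single, M.symmetric j i]
    ring

/-- The geometric representation of a Coxeter group. -/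
noncomputable def geometricRepresentation : W →* ((B →₀ ℝ) ≃ₗ[ℝ] (B →₀ ℝ)) :=
  cs.lift ⟨simpleReflection M, isLiftable_simpleReflection⟩

theorem geometricRepresentation_simple_apply (i : B) (z : B →₀ ℝ) :
    geometricRepresentation cs (cs.simple i) z =
      z - simpleCoroot M i z • Finsupp.single i 1 := by
  rw [geometricRepresentation, cs.lift_apply_simple, simpleReflection, reflection_apply]

theorem geometricRepresentation_apply_of_mem_closure {T : Set B} {w : W}
    (hw : w ∈ Subgroup.closure (cs.simple '' T)) {i : B} (hi : i ∉ T) (z : B →₀ ℝ) :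
    geometricRepresentation cs w z i = z i := by
  induction hw using Subgroup.closure_induction generalizing z with
  | mem x hx =>
    obtain ⟨t, ht, rfl⟩ := hx
    have hti : t ≠ i := fun h => hi (h ▸ ht)
    simp [geometricRepresentation_simple_apply, Finsupp.single_eq_of_ne hti.symm]
  | one => simp
  | mul x y hx hy ihx ihy => rw [map_mul, LinearEquiv.mul_apply, ihx, ihy]
  | inv x hx ih =>
    rw [← ih, ← LinearEquiv.mul_apply, ← map_mul, mul_inv_cancel, map_one, LinearEquiv.coe_one, id]

theorem eq_two_of_conj_mem_closure {T : Set B} {i t : B} (hi : i ∉ T) (ht : t ∈ T)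
    (h : cs.simple i * cs.simple t * cs.simple i ∈ Subgroup.closure (cs.simple '' T)) :
    M i t = 2 := by
  have hti : t ≠ i := fun h => hi (h ▸ ht)
  have hcoef := geometricRepresentation_apply_of_mem_closure cs h hi (Finsupp.single i 1)
  simp only [map_mul, LinearEquiv.mul_apply, geometricRepresentation_simple_apply, map_sub,
    map_smul, simpleCoroot_single, Finsupp.sub_apply, Finsupp.smul_apply, Finsupp.single_eq_same,
    Finsupp.single_eq_of_ne hti.symm, M.symmetric t i, M.diagonal, smul_eq_mul, Nat.cast_one,
    div_one, cos_pi]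
    at hcoef
  have hcos : cos (π / M i t) = 0 := by
    have : cos (π / M i t) ^ 2 = 0 := by linarith
    exact pow_eq_zero_iff two_ne_zero |>.mp this
  obtain h0 | h1 | h2 | h3 : M i t = 0 ∨ M i t = 1 ∨ M i t = 2 ∨ 3 ≤ M i t := by omega
  · simp [h0] at hcos
  · simp [h1] at hcos
  · exact h2
  · have h3' : (3 : ℝ) ≤ M i t := by exact_mod_cast h3
    refine absurd hcos (cos_pos_of_mem_Ioo ⟨?_, ?_⟩).ne'
    · have : 0 ≤ π / M i t := by positivity
      linarith [pi_pos]
    · exact div_lt_div_of_pos_left pi_pos two_pos (by linarith)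

end GeometricRepresentation

/-- Let `T ⊆ S` with `W_T` finite and let `w_T` be the longest
element of `W_T`. For `s ∈ S - T`, `s` commutes with `w_T` if and only if
`m_{st} = 2` for all `t ∈ T`. -/
theorem simple_commutes_with_longest_element_iff
    {B W : Type*} [Fintype B] [Group W] {M : CoxeterMatrix B} (cs : CoxeterSystem M W)
    (T : Set B) (hfin : Finite (Subgroup.closure (cs.simple '' T) : Subgroup W))
    (w₀ : W) (hw₀ : w₀ ∈ Subgroup.closure (cs.simple '' T))
    (hlong : ∀ x ∈ Subgroup.closure (cs.simple '' T), cs.length x ≤ cs.length w₀)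
    (i : B) (hi : i ∉ T) :
    cs.simple i * w₀ = w₀ * cs.simple i ↔ ∀ t ∈ T, M i t = 2 := by
  constructor
  · intro hcomm t ht
    refine eq_two_of_conj_mem_closure cs hi ht (conj_mem_closure_of_commute cs hw₀ hcomm ?_)
    exact lt_of_le_of_ne (hlong _ (mul_mem hw₀ (Subgroup.subset_closure ⟨t, ht, rfl⟩)))
      (cs.length_mul_simple_ne w₀ t)
  · intro h
    have hle : Subgroup.closure (cs.simple '' T) ≤ Subgroup.centralizer {cs.simple i} := by
      rw [Subgroup.closure_le]
      rintro _ ⟨t, ht, rfl⟩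
      rw [SetLike.mem_coe, Subgroup.mem_centralizer_singleton_iff]
      have hsq := cs.simple_mul_simple_pow i t
      rw [h t ht, pow_two, mul_eq_one_iff_eq_inv, mul_inv_rev, cs.inv_simple, cs.inv_simple] at hsq
      exact hsq.symm
    exact (Subgroup.mem_centralizer_singleton_iff.mp (hle hw₀)).symm

end CoxeterPaper
end
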